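/- Let a, b, c be pairwise coprime positive integers and t a nonnegative integer. Then, as an identity of complex numbers, N_t(a,b,c) equals t²/(2abc) + (t/2)·(1/(ab) + 1/(ac) + 1/(bc)) + (1/12)·(3/a + 3/b + 3/c + a/(bc) + b/(ac) + c/(ab)) minus the three sums (1/(4a))·Σ_{k=1}^{a−1} e^{(πik/a)(2t+b+c)}/(sin(πkb/a)·sin(πkc/a)), (1/(4b))·Σ_{k=1}^{b−1} e^{(πik/b)(2t+a+c)}/(sin(πka/b)·sin(πkc/b)), and (1/(4c))·Σ_{k=1}^{c−1} e^{(πik/c)(2t+a+b)}/(sin(πka/c)·sin(πkb/c)). -/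

import Mathlib

open Complex Real Finset

/-- The number of representations of `t` as a nonnegative integer combination
`a*m₁ + b*m₂ + c*m₃`. -/
noncomputable def frobN (a b c t : ℕ) : ℕ :=
  Nat.card {p : ℕ × ℕ × ℕ // a * p.1 + b * p.2.1 + c * p.2.2 = t}

open Polynomial in
/-- The polynomial `1 + μX + ⋯ + (μX)^(n-1)`. -/
noncomputable def geomPoly (μ : ℂ) (n : ℕ) : ℂ[X] :=
  ∑ j ∈ Finset.range n, (C μ * X) ^ j

/-- The complex `n`-th roots of unity other than `1`. -/
noncomputable def nontrivialRoots (n : ℕ) : Finset ℂ :=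
  (Polynomial.nthRootsFinset n (1 : ℂ)).erase 1

/-- The coefficient of `1 / (1 - μX)` in the partial fraction expansion of
`1 / ((1 - X^a) (1 - X^b) (1 - X^c))`, for `μ ≠ 1` an `a`-th root of unity. -/
noncomputable def residueCoeff (a b c : ℕ) (μ : ℂ) : ℂ :=
  (a * ((1 - μ⁻¹ ^ b) * (1 - μ⁻¹ ^ c)))⁻¹

open Polynomial in
/-- The numerator over `1 - X^a` of the part of the partial fraction expansion of
`1 / ((1 - X^a) (1 - X^b) (1 - X^c))` with poles at the nontrivial `a`-th roots of unity. -/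
noncomputable def residuePoly (a b c : ℕ) : ℂ[X] :=
  ∑ μ ∈ nontrivialRoots a, C (residueCoeff a b c μ) * geomPoly μ a

theorem mem_nontrivialRoots {n : ℕ} (hn : 0 < n) {μ : ℂ} :
    μ ∈ nontrivialRoots n ↔ μ ≠ 1 ∧ μ ^ n = 1 := by
  simp [nontrivialRoots, Polynomial.mem_nthRootsFinset hn]

theorem card_nontrivialRoots {n : ℕ} (hn : 0 < n) : (nontrivialRoots n).card = n - 1 := by
  rw [nontrivialRoots, Finset.card_erase_of_mem (Polynomial.one_mem_nthRootsFinset hn),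
    (Complex.isPrimitiveRoot_exp n hn.ne').card_nthRootsFinset]

theorem eq_one_of_pow_eq_one_of_coprime {m n : ℕ} (h : Nat.Coprime m n) {x : ℂ}
    (hm : x ^ m = 1) (hn : x ^ n = 1) : x = 1 := by
  have := pow_gcd_eq_one.mpr ⟨hm, hn⟩
  rwa [h.gcd_eq_one, pow_one] at this

theorem disjoint_nontrivialRoots {m n : ℕ} (hm : 0 < m) (hn : 0 < n) (h : Nat.Coprime m n) :
    Disjoint (nontrivialRoots m) (nontrivialRoots n) := by
  rw [Finset.disjoint_left]
  intro x hx hx'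
  rw [mem_nontrivialRoots hm] at hx
  rw [mem_nontrivialRoots hn] at hx'
  exact hx.1 (eq_one_of_pow_eq_one_of_coprime h hx.2 hx'.2)

theorem nontrivialRoots_eq_image {n : ℕ} (hn : 0 < n) :
    nontrivialRoots n =
      (Finset.Icc 1 (n - 1)).image fun k : ℕ => Complex.exp (2 * Real.pi * Complex.I / n) ^ k := by
  have hζ := Complex.isPrimitiveRoot_exp n hn.ne'
  have : NeZero n := ⟨hn.ne'⟩
  ext x
  rw [mem_nontrivialRoots hn, Finset.mem_image]
  constructor
  · rintro ⟨hx1, hxn⟩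
    obtain ⟨i, hi, rfl⟩ := hζ.eq_pow_of_pow_eq_one hxn
    refine ⟨i, Finset.mem_Icc.mpr ⟨Nat.one_le_iff_ne_zero.mpr ?_, by omega⟩, rfl⟩
    rintro rfl
    exact hx1 (pow_zero _)
  · rintro ⟨k, hk, rfl⟩
    rw [Finset.mem_Icc] at hk
    refine ⟨hζ.pow_ne_one_of_pos_of_lt (by omega) (by omega), ?_⟩
    rw [pow_right_comm, hζ.pow_eq_one, one_pow]

theorem sum_nontrivialRoots {n : ℕ} (hn : 0 < n) (f : ℂ → ℂ) :
    ∑ μ ∈ nontrivialRoots n, f μ =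
      ∑ k ∈ Finset.Icc 1 (n - 1), f (Complex.exp (2 * Real.pi * Complex.I / n) ^ k) := by
  rw [nontrivialRoots_eq_image hn, Finset.sum_image]
  intro i hi j hj hij
  simp only [Finset.coe_Icc, Set.mem_Icc] at hi hj
  exact (Complex.isPrimitiveRoot_exp n hn.ne').pow_inj (by omega) (by omega) hij

section Polynomial

open Polynomial

theorem geomPoly_mul_one_sub (μ : ℂ) (n : ℕ) :
    geomPoly μ n * (1 - C μ * X) = 1 - C (μ ^ n) * X ^ n := by
  rw [geomPoly, geom_sum_mul_neg, mul_pow, C_pow]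

theorem natDegree_geomPoly_le (μ : ℂ) (n : ℕ) : (geomPoly μ n).natDegree ≤ n - 1 := by
  refine natDegree_sum_le_of_forall_le _ _ fun j hj => ?_
  rw [mul_pow, ← C_pow]
  have := Finset.mem_range.mp hj
  exact (natDegree_C_mul_X_pow_le _ _).trans (by omega)

theorem natDegree_residuePoly_le (a b c : ℕ) : (residuePoly a b c).natDegree ≤ a - 1 :=
  natDegree_sum_le_of_forall_le _ _ fun _ _ =>
    (natDegree_C_mul_le _ _).trans (natDegree_geomPoly_le _ _)

theorem eval_geomPoly_of_ne {n : ℕ} {μ x : ℂ} (h : (μ * x) ^ n = 1) (hne : μ * x ≠ 1) :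
    (geomPoly μ n).eval x = 0 := by
  have := geom_sum_mul (μ * x) n
  rw [h, sub_self] at this
  simpa [geomPoly, eval_finsetSum] using
    (mul_eq_zero.mp this).resolve_right (sub_ne_zero.mpr hne)

theorem eval_geomPoly_of_eq {n : ℕ} {μ x : ℂ} (h : μ * x = 1) :
    (geomPoly μ n).eval x = n := by
  simp [geomPoly, eval_finsetSum, h]

theorem eval_residuePoly_one {a : ℕ} (ha : 0 < a) (b c : ℕ) :
    (residuePoly a b c).eval 1 = 0 := by
  rw [residuePoly, eval_finsetSum]
  refine Finset.sum_eq_zero fun μ hμ => ?_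
  rw [mem_nontrivialRoots ha] at hμ
  rw [eval_mul, eval_geomPoly_of_ne (by simpa using hμ.2) (by simpa using hμ.1), mul_zero]

theorem eval_residuePoly {a b c : ℕ} (ha : 0 < a) (hab : Nat.Coprime a b)
    (hac : Nat.Coprime a c) {x : ℂ} (hx : x ∈ nontrivialRoots a) :
    (1 - x ^ b) * (1 - x ^ c) * (residuePoly a b c).eval x = 1 := by
  obtain ⟨hx1, hxa⟩ := (mem_nontrivialRoots ha).mp hx
  have hx0 : x ≠ 0 := by
    rintro rfl
    simp [ha.ne'] at hxa
  have hb : 1 - x ^ b ≠ 0 := fun h =>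
    hx1 (eq_one_of_pow_eq_one_of_coprime hab hxa (sub_eq_zero.mp h).symm)
  have hc : 1 - x ^ c ≠ 0 := fun h =>
    hx1 (eq_one_of_pow_eq_one_of_coprime hac hxa (sub_eq_zero.mp h).symm)
  have ha' : (a : ℂ) ≠ 0 := Nat.cast_ne_zero.mpr ha.ne'
  rw [residuePoly, eval_finsetSum, Finset.sum_eq_single x⁻¹]
  · rw [eval_mul, eval_C, eval_geomPoly_of_eq (inv_mul_cancel₀ hx0), residueCoeff, inv_inv]
    field_simp
  · intro μ hμ hne
    rw [mem_nontrivialRoots ha] at hμ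
    rw [eval_mul, eval_geomPoly_of_ne (by rw [mul_pow, hμ.2, hxa, one_mul])
      (fun h => hne (eq_inv_of_mul_eq_one_left h)), mul_zero]
  · intro h
    exact absurd ((mem_nontrivialRoots ha).mpr
      ⟨by simpa using hx1, by rw [inv_pow, hxa, inv_one]⟩) h

/-- The expansion of `1 + X + ⋯ + X^(n-1)` at `1` to second order. -/
theorem exists_geomPoly_one_eq (n : ℕ) :
    ∃ r : ℂ[X], geomPoly 1 n = C (n : ℂ) + C ((n : ℂ) * (n - 1) / 2) * (X - 1) +
      C ((n : ℂ) * (n - 1) * (n - 2) / 6) * (X - 1) ^ 2 + (X - 1) ^ 3 * r := by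
  have hpow (n : ℕ) : ∃ r : ℂ[X], X ^ n = 1 + C (n : ℂ) * (X - 1) +
      C ((n : ℂ) * (n - 1) / 2) * (X - 1) ^ 2 + (X - 1) ^ 3 * r := by
    induction n with
    | zero => exact ⟨0, by simp⟩
    | succ n ih =>
      obtain ⟨r, hr⟩ := ih
      have h : ((n + 1 : ℕ) : ℂ) * ((n + 1 : ℕ) - 1) / 2 = n * (n - 1) / 2 + n := by
        push_cast; ring
      refine ⟨r * X + C ((n : ℂ) * (n - 1) / 2), ?_⟩
      rw [pow_succ, hr, h, Nat.cast_succ]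
      simp only [map_add, map_one]
      ring
  induction n with
  | zero => exact ⟨0, by simp [geomPoly]⟩
  | succ n ih =>
    obtain ⟨r, hr⟩ := ih
    obtain ⟨s, hs⟩ := hpow n
    have h₁ : ((n + 1 : ℕ) : ℂ) * ((n + 1 : ℕ) - 1) / 2 = n * (n - 1) / 2 + n := by
      push_cast; ring
    have h₂ : ((n + 1 : ℕ) : ℂ) * ((n + 1 : ℕ) - 1) * ((n + 1 : ℕ) - 2) / 6 =
        n * (n - 1) * (n - 2) / 6 + n * (n - 1) / 2 := by
      push_cast; ring
    refine ⟨r + s, ?_⟩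
    have h : geomPoly 1 (n + 1) = geomPoly 1 n + X ^ n := by
      simp [geomPoly, Finset.sum_range_succ]
    rw [h, hr, hs, h₁, h₂, Nat.cast_succ]
    simp only [map_add, map_one]
    ring

theorem exists_mul_expansion {p q r s : ℂ[X]} {p₀ p₁ p₂ q₀ q₁ q₂ : ℂ}
    (hp : p = C p₀ + C p₁ * (X - 1) + C p₂ * (X - 1) ^ 2 + (X - 1) ^ 3 * r)
    (hq : q = C q₀ + C q₁ * (X - 1) + C q₂ * (X - 1) ^ 2 + (X - 1) ^ 3 * s) :
    ∃ w : ℂ[X], p * q = C (p₀ * q₀) + C (p₀ * q₁ + p₁ * q₀) * (X - 1) +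
      C (p₀ * q₂ + p₁ * q₁ + p₂ * q₀) * (X - 1) ^ 2 + (X - 1) ^ 3 * w := by
  refine ⟨C p₁ * C q₂ + C p₂ * C q₁ + C p₂ * C q₂ * (X - 1) + r * q + s * p
    - (X - 1) ^ 3 * r * s, ?_⟩
  subst hp hq
  simp only [map_add, map_mul]
  ring

/-- The principal part of `1 / ((1 - X^a) (1 - X^b) (1 - X^c))` at `1`, multiplied by
`(1 - X)^3`. -/
noncomputable def principalPoly (a b c : ℕ) : ℂ[X] :=
  C (1 / ((a : ℂ) * b * c)) + C (-(((a : ℂ) + b + c - 3) / (2 * (a * b * c)))) * (X - 1) +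
    C ((1 / 12) * (3 / (a : ℂ) + 3 / b + 3 / c + a / (b * c) + b / (a * c) + c / (a * b)) -
      1 / (a * b * c) - ((a : ℂ) + b + c - 3) / (2 * (a * b * c))) * (X - 1) ^ 2

theorem dvd_one_sub_principalPoly_mul {a b c : ℕ} (ha : 0 < a) (hb : 0 < b) (hc : 0 < c) :
    (X - 1) ^ 3 ∣ 1 - principalPoly a b c * (geomPoly 1 a * geomPoly 1 b * geomPoly 1 c) := by
  obtain ⟨r, hr⟩ := exists_geomPoly_one_eq a
  obtain ⟨s, hs⟩ := exists_geomPoly_one_eq b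
  obtain ⟨u, hu⟩ := exists_geomPoly_one_eq c
  obtain ⟨v, hv⟩ := exists_mul_expansion hr hs
  obtain ⟨w, hw⟩ := exists_mul_expansion hv hu
  obtain ⟨z, hz⟩ := exists_mul_expansion (r := 0)
    (by rw [principalPoly, mul_zero, add_zero] : principalPoly a b c = _) hw
  have ha' : (a : ℂ) ≠ 0 := Nat.cast_ne_zero.mpr ha.ne'
  have hb' : (b : ℂ) ≠ 0 := Nat.cast_ne_zero.mpr hb.ne'
  have hc' : (c : ℂ) ≠ 0 := Nat.cast_ne_zero.mpr hc.ne'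
  refine ⟨-z, ?_⟩
  rw [hz]
  have key {k₀ k₁ k₂ : ℂ} (h₀ : k₀ = 1) (h₁ : k₁ = 0) (h₂ : k₂ = 0) :
      1 - (C k₀ + C k₁ * (X - 1) + C k₂ * (X - 1) ^ 2 + (X - 1) ^ 3 * z) =
        (X - 1) ^ 3 * -z := by
    subst h₀ h₁ h₂
    simp
  apply key
  · field_simp
  · field_simp
    ring
  · field_simp
    ring

theorem dvd_one_sub_pow_mul_residuePoly {a : ℕ} (ha : 0 < a) (b c : ℕ) :
    (X - 1) ^ 3 ∣ (1 - X ^ b) * (1 - X ^ c) * residuePoly a b c := by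
  have h (n : ℕ) : (X - 1 : ℂ[X]) ∣ 1 - X ^ n := by
    rw [← dvd_neg, neg_sub]
    exact sub_one_dvd_pow_sub_one X n
  have h' : (X - 1 : ℂ[X]) ∣ residuePoly a b c := by
    rw [← C_1, dvd_iff_isRoot]
    exact eval_residuePoly_one ha b c
  rw [show (X - 1 : ℂ[X]) ^ 3 = (X - 1) * (X - 1) * (X - 1) by ring]
  exact mul_dvd_mul (mul_dvd_mul (h b) (h c)) h'

theorem eval_geomPoly_one_of_mem {n : ℕ} (hn : 0 < n) {x : ℂ} (hx : x ∈ nontrivialRoots n) :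
    (geomPoly 1 n).eval x = 0 := by
  rw [mem_nontrivialRoots hn] at hx
  exact eval_geomPoly_of_ne (by simpa using hx.2) (by simpa using hx.1)

/-- The partial fraction expansion of `1 / ((1 - X^a) (1 - X^b) (1 - X^c))`, with denominators
cleared. -/
theorem partialFraction_identity {a b c : ℕ} (ha : 0 < a) (hb : 0 < b) (hc : 0 < c)
    (hab : Nat.Coprime a b) (hac : Nat.Coprime a c) (hbc : Nat.Coprime b c) :
    principalPoly a b c * (geomPoly 1 a * geomPoly 1 b * geomPoly 1 c) +
      (1 - X ^ b) * (1 - X ^ c) * residuePoly a b c +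
      (1 - X ^ a) * (1 - X ^ c) * residuePoly b a c +
      (1 - X ^ a) * (1 - X ^ b) * residuePoly c a b = 1 := by
  set P : ℂ[X] := 1 - principalPoly a b c * (geomPoly 1 a * geomPoly 1 b * geomPoly 1 c) -
      (1 - X ^ b) * (1 - X ^ c) * residuePoly a b c -
      (1 - X ^ a) * (1 - X ^ c) * residuePoly b a c -
      (1 - X ^ a) * (1 - X ^ b) * residuePoly c a b with hP
  suffices P = 0 by linear_combination -this
  have hdeg : P.natDegree < a + b + c := by
    have h1 (n : ℕ) : (1 - X ^ n : ℂ[X]).natDegree ≤ n := by compute_degree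
    have hpr : (principalPoly a b c).natDegree ≤ 2 := by
      unfold principalPoly
      compute_degree
    have hres (k l m : ℕ) (hk : 0 < k) (hs : k + l + m = a + b + c) :
        ((1 - X ^ l) * (1 - X ^ m) * residuePoly k l m).natDegree ≤ a + b + c - 1 :=
      (natDegree_mul_le_of_le (natDegree_mul_le_of_le (h1 l) (h1 m))
        (natDegree_residuePoly_le k l m)).trans (by omega)
    have hmain : (principalPoly a b c *
        (geomPoly 1 a * geomPoly 1 b * geomPoly 1 c)).natDegree ≤ a + b + c - 1 :=
      (natDegree_mul_le_of_le hpr (natDegree_mul_le_of_le (natDegree_mul_le_of_le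
        (natDegree_geomPoly_le 1 a) (natDegree_geomPoly_le 1 b))
        (natDegree_geomPoly_le 1 c))).trans (by omega)
    have : P.natDegree ≤ max (max (max (max 0 _) _) _) _ :=
      natDegree_sub_le_of_le (natDegree_sub_le_of_le (natDegree_sub_le_of_le
        (natDegree_sub_le_of_le natDegree_one.le hmain) (hres a b c ha rfl))
        (hres b a c hb (by omega))) (hres c a b hc (by omega))
    omega
  obtain ⟨Q, hQ⟩ : (X - 1) ^ 3 ∣ P :=
    dvd_sub (dvd_sub (dvd_sub (dvd_one_sub_principalPoly_mul ha hb hc)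
      (dvd_one_sub_pow_mul_residuePoly ha b c)) (dvd_one_sub_pow_mul_residuePoly hb a c))
      (dvd_one_sub_pow_mul_residuePoly hc a b)
  by_contra hne
  have hQ0 : Q ≠ 0 := by
    rintro rfl
    exact hne (by rw [hQ, mul_zero])
  have hQdeg : P.natDegree = 3 + Q.natDegree := by
    have hmonic : ((X - 1 : ℂ[X]) ^ 3).Monic := by
      rw [← C_1]
      exact (monic_X_sub_C 1).pow 3
    rw [hQ, hmonic.natDegree_mul' hQ0, ← C_1, natDegree_pow, natDegree_X_sub_C, mul_one]
  have hroot {x : ℂ} (hx1 : x ≠ 1) (hx : P.eval x = 0) : Q.eval x = 0 := by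
    rw [hQ, eval_mul] at hx
    refine (mul_eq_zero.mp hx).resolve_left ?_
    simpa using sub_ne_zero.mpr hx1
  refine hQ0 (eq_zero_of_natDegree_lt_card_of_eval_eq_zero' Q
    ((nontrivialRoots a ∪ nontrivialRoots b) ∪ nontrivialRoots c) (fun x hx => ?_) ?_)
  · rw [Finset.mem_union, Finset.mem_union] at hx
    rcases hx with (hx | hx) | hx
    · obtain ⟨hx1, hxn⟩ := (mem_nontrivialRoots ha).mp hx
      refine hroot hx1 ?_
      have := eval_residuePoly ha hab hac hx
      simp [hP, eval_geomPoly_one_of_mem ha hx, hxn, this]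
    · obtain ⟨hx1, hxn⟩ := (mem_nontrivialRoots hb).mp hx
      refine hroot hx1 ?_
      have := eval_residuePoly hb hab.symm hbc hx
      simp [hP, eval_geomPoly_one_of_mem hb hx, hxn, this]
    · obtain ⟨hx1, hxn⟩ := (mem_nontrivialRoots hc).mp hx
      refine hroot hx1 ?_
      have := eval_residuePoly hc hac.symm hbc.symm hx
      simp [hP, eval_geomPoly_one_of_mem hc hx, hxn, this]
  · rw [Finset.card_union_of_disjoint (Finset.disjoint_union_left.mpr
        ⟨disjoint_nontrivialRoots ha hc hac, disjoint_nontrivialRoots hb hc hbc⟩),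
      Finset.card_union_of_disjoint (disjoint_nontrivialRoots ha hb hab),
      card_nontrivialRoots ha, card_nontrivialRoots hb, card_nontrivialRoots hc]
    omega

end Polynomial

section PowerSeries

open PowerSeries

/-- The power series `1 / (1 - μX)`. -/
noncomputable def geomSeries (μ : ℂ) : ℂ⟦X⟧ := mk fun n => μ ^ n

theorem one_sub_mul_geomSeries (μ : ℂ) : (1 - C μ * X) * geomSeries μ = 1 := by
  ext n
  rw [sub_mul, one_mul, map_sub, mul_assoc, coeff_C_mul]
  cases n with
  | zero => simp [geomSeries]
  | succ n => simp [geomSeries, coeff_succ_X_mul, pow_succ', coeff_one]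

/-- The power series `1 / (1 - X^n)`. -/
noncomputable def multiplesSeries (n : ℕ) : ℂ⟦X⟧ := mk fun k => if n ∣ k then 1 else 0

theorem one_sub_mul_multiplesSeries {n : ℕ} (hn : 0 < n) :
    (1 - X ^ n) * multiplesSeries n = 1 := by
  ext k
  rw [sub_mul, one_mul, map_sub, coeff_X_pow_mul', coeff_one, multiplesSeries, coeff_mk, coeff_mk]
  rcases Nat.eq_zero_or_pos k with rfl | hk
  · simp [hn.ne']
  · rw [if_neg hk.ne']
    split_ifs with h1 h2 h3 h4 h5
    · simp
    · exact absurd (Nat.dvd_sub h1 dvd_rfl) h3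
    · exact absurd (Nat.le_of_dvd hk h1) h2
    · exact absurd ((Nat.dvd_sub_iff_left h4 dvd_rfl).mp h5) h1
    · simp
    · simp

theorem frobN_eq_card_filter {a b c : ℕ} (ha : 0 < a) (hb : 0 < b) (hc : 0 < c) (t : ℕ) :
    frobN a b c t = (((Finset.HasAntidiagonal.antidiagonal t).sigma
      fun p => Finset.HasAntidiagonal.antidiagonal p.2).filter fun x =>
        a ∣ x.1.1 ∧ b ∣ x.2.1 ∧ c ∣ x.2.2).card := by
  rw [frobN, ← Fintype.card_coe, ← Nat.card_eq_fintype_card]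
  refine Nat.card_eq_of_bijective
    (fun p => ⟨⟨(a * p.1.1, b * p.1.2.1 + c * p.1.2.2), (b * p.1.2.1, c * p.1.2.2)⟩, ?_⟩)
    ⟨?_, ?_⟩
  · have := p.2
    simp only [Finset.mem_filter, Finset.mem_sigma, Finset.HasAntidiagonal.mem_antidiagonal]
    exact ⟨⟨by omega, trivial⟩, dvd_mul_right _ _, dvd_mul_right _ _, dvd_mul_right _ _⟩
  · rintro ⟨⟨x, y, z⟩, h⟩ ⟨⟨x', y', z'⟩, h'⟩ heq
    simp only [Subtype.mk.injEq, Sigma.mk.injEq, Prod.mk.injEq, heq_eq_eq] at heq ⊢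
    exact ⟨Nat.eq_of_mul_eq_mul_left ha heq.1.1, Nat.eq_of_mul_eq_mul_left hb heq.2.1,
      Nat.eq_of_mul_eq_mul_left hc heq.2.2⟩
  · rintro ⟨⟨⟨i, j⟩, ⟨k, l⟩⟩, h⟩
    simp only [Finset.mem_filter, Finset.mem_sigma, Finset.HasAntidiagonal.mem_antidiagonal] at h
    obtain ⟨⟨hij, rfl⟩, ⟨x, rfl⟩, ⟨y, rfl⟩, ⟨z, rfl⟩⟩ := h
    exact ⟨⟨(x, y, z), by rw [← hij, add_assoc]⟩, rfl⟩

theorem mk_frobN_eq {a b c : ℕ} (ha : 0 < a) (hb : 0 < b) (hc : 0 < c) :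
    (PowerSeries.mk fun t => (frobN a b c t : ℂ)) =
      multiplesSeries a * (multiplesSeries b * multiplesSeries c) := by
  ext t
  rw [coeff_mk, frobN_eq_card_filter ha hb hc, coeff_mul, Finset.card_filter, Finset.sum_sigma]
  push_cast
  refine Finset.sum_congr rfl fun p _ => ?_
  rw [coeff_mul, Finset.mul_sum]
  refine Finset.sum_congr rfl fun q _ => ?_
  simp only [multiplesSeries, coeff_mk, ite_and]
  split_ifs <;> simp

theorem one_sub_mul_mk_frobN {a b c : ℕ} (ha : 0 < a) (hb : 0 < b) (hc : 0 < c) :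
    (1 - X ^ a) * (1 - X ^ b) * (1 - X ^ c) * (PowerSeries.mk fun t => (frobN a b c t : ℂ)) = 1 := by
  rw [mk_frobN_eq ha hb hc]
  linear_combination (1 - X ^ b) * multiplesSeries b * ((1 - X ^ c) * multiplesSeries c) *
    one_sub_mul_multiplesSeries ha + (1 - X ^ c) * multiplesSeries c *
    one_sub_mul_multiplesSeries hb + one_sub_mul_multiplesSeries hc

theorem coe_geomPoly_mul_one_sub (μ : ℂ) (n : ℕ) :
    (geomPoly μ n : ℂ⟦X⟧) * (1 - C μ * X) = 1 - C (μ ^ n) * X ^ n := by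
  have := congrArg (fun p : Polynomial ℂ => (p : ℂ⟦X⟧)) (geomPoly_mul_one_sub μ n)
  simpa using this

theorem coeff_residuePoly_mul {a : ℕ} (ha : 0 < a) (b c t : ℕ) {G : ℂ⟦X⟧}
    (hG : (1 - X ^ a) * G = 1) :
    coeff t ((residuePoly a b c : ℂ⟦X⟧) * G) =
      ∑ μ ∈ nontrivialRoots a, residueCoeff a b c μ * μ ^ t := by
  have h : (residuePoly a b c : ℂ⟦X⟧) =
      ∑ μ ∈ nontrivialRoots a, C (residueCoeff a b c μ) * (geomPoly μ a : ℂ⟦X⟧) := by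
    rw [residuePoly, ← Polynomial.coeToPowerSeries.ringHom_apply, map_sum]
    simp
  rw [h, Finset.sum_mul, map_sum]
  refine Finset.sum_congr rfl fun μ hμ => ?_
  have hμa := coe_geomPoly_mul_one_sub μ a
  rw [((mem_nontrivialRoots ha).mp hμ).2, map_one, one_mul] at hμa
  have : (geomPoly μ a : ℂ⟦X⟧) * G = geomSeries μ := by
    linear_combination -(geomPoly μ a : ℂ⟦X⟧) * G * one_sub_mul_geomSeries μ +
      G * geomSeries μ * hμa + geomSeries μ * hG
  rw [mul_assoc, this, coeff_C_mul, geomSeries, coeff_mk]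

theorem coeff_principalPoly_mul (a b c t : ℕ) {G : ℂ⟦X⟧} (hG : (1 - X) ^ 3 * G = 1) :
    coeff t ((principalPoly a b c : ℂ⟦X⟧) * G) =
      (t : ℂ) ^ 2 / (2 * a * b * c) +
        ((t : ℂ) / 2) * (((a : ℂ) + b + c) / (a * b * c)) +
        (1 / 12) * (3 / a + 3 / b + 3 / c + a / (b * c) + b / (a * c) + c / (a * b)) := by
  have h1 : (PowerSeries.mk 1 : ℂ⟦X⟧) * (1 - X) = 1 := mk_one_mul_one_sub_eq_one ℂ
  have hG3 : G = PowerSeries.mk 1 ^ (2 + 1) := by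
    linear_combination (PowerSeries.mk 1 : ℂ⟦X⟧) ^ 3 * hG -
      G * (1 + PowerSeries.mk 1 * (1 - X) + (PowerSeries.mk 1 * (1 - X)) ^ 2) * h1
  have hG2 : (X - 1) * G = -PowerSeries.mk 1 ^ (1 + 1) := by
    rw [hG3]
    linear_combination -(PowerSeries.mk 1 : ℂ⟦X⟧) ^ 2 * h1
  have hG1 : (X - 1) ^ 2 * G = PowerSeries.mk 1 := by
    rw [hG3]
    linear_combination (PowerSeries.mk 1 : ℂ⟦X⟧) * (1 + PowerSeries.mk 1 * (1 - X)) * h1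
  rw [principalPoly]
  push_cast
  rw [add_mul, add_mul, mul_assoc _ (X - 1) G, mul_assoc _ ((X - 1) ^ 2) G, hG2, hG1, hG3,
    mk_one_pow_eq_mk_choose_add, mk_one_pow_eq_mk_choose_add]
  simp only [map_add, map_neg, neg_mul, mul_neg, neg_neg, coeff_C_mul, coeff_mk, Pi.one_apply]
  rw [Nat.add_comm 2 t, Nat.cast_choose_two, Nat.choose_one_right]
  push_cast
  ring

/-- The partial fraction formula for `frobN`, with sums over roots of unity. -/
theorem frobN_eq_sum_residueCoeff {a b c : ℕ} (ha : 0 < a) (hb : 0 < b) (hc : 0 < c)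
    (hab : Nat.Coprime a b) (hac : Nat.Coprime a c) (hbc : Nat.Coprime b c) (t : ℕ) :
    (frobN a b c t : ℂ) =
      (t : ℂ) ^ 2 / (2 * a * b * c) +
        ((t : ℂ) / 2) * (((a : ℂ) + b + c) / (a * b * c)) +
        (1 / 12) * (3 / a + 3 / b + 3 / c + a / (b * c) + b / (a * c) + c / (a * b)) +
        ∑ μ ∈ nontrivialRoots a, residueCoeff a b c μ * μ ^ t +
        ∑ μ ∈ nontrivialRoots b, residueCoeff b a c μ * μ ^ t +
        ∑ μ ∈ nontrivialRoots c, residueCoeff c a b μ * μ ^ t := by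
  set F : ℂ⟦X⟧ := PowerSeries.mk fun t => (frobN a b c t : ℂ) with hFdef
  have hF : (1 - X ^ a) * (1 - X ^ b) * (1 - X ^ c) * F = 1 := one_sub_mul_mk_frobN ha hb hc
  have hone (n : ℕ) : (geomPoly 1 n : ℂ⟦X⟧) * (1 - X) = 1 - X ^ n := by
    simpa using coe_geomPoly_mul_one_sub 1 n
  have hid := congrArg (fun p : Polynomial ℂ => (p : ℂ⟦X⟧) * F)
    (partialFraction_identity ha hb hc hab hac hbc)
  push_cast at hid
  have hsplit : F =
      (principalPoly a b c : ℂ⟦X⟧) *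
        ((geomPoly 1 a : ℂ⟦X⟧) * (geomPoly 1 b : ℂ⟦X⟧) * (geomPoly 1 c : ℂ⟦X⟧) * F) +
      (residuePoly a b c : ℂ⟦X⟧) * ((1 - X ^ b) * (1 - X ^ c) * F) +
      (residuePoly b a c : ℂ⟦X⟧) * ((1 - X ^ a) * (1 - X ^ c) * F) +
      (residuePoly c a b : ℂ⟦X⟧) * ((1 - X ^ a) * (1 - X ^ b) * F) := by
    linear_combination -hid
  have ht : (frobN a b c t : ℂ) = coeff t F := by rw [hFdef, coeff_mk]
  rw [ht, hsplit]
  simp only [map_add]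
  rw [coeff_principalPoly_mul a b c t, coeff_residuePoly_mul ha, coeff_residuePoly_mul hb,
    coeff_residuePoly_mul hc]
  · linear_combination hF
  · linear_combination hF
  · linear_combination hF
  · rw [← hone a, ← hone b, ← hone c] at hF
    linear_combination hF

end PowerSeries

theorem one_sub_exp_neg (θ : ℝ) :
    1 - Complex.exp (-(2 * θ * Complex.I)) =
      2 * Complex.I * Complex.exp (-(θ * Complex.I)) * (Real.sin θ : ℂ) := by
  have h₁ : Complex.exp (-(2 * θ * Complex.I)) = Complex.exp (-(θ * Complex.I)) ^ 2 := by
    rw [← Complex.exp_nat_mul]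
    push_cast
    ring_nf
  have h₂ : Complex.exp (-(θ * Complex.I)) * Complex.exp (θ * Complex.I) = 1 := by
    rw [← Complex.exp_add, neg_add_cancel, Complex.exp_zero]
  rw [Complex.ofReal_sin, Complex.sin, h₁, ← neg_mul]
  rw [← neg_mul] at h₂
  linear_combination (Complex.exp (-θ * Complex.I) * Complex.exp (θ * Complex.I) -
    Complex.exp (-θ * Complex.I) ^ 2) * Complex.I_sq - h₂

theorem residueCoeff_mul_pow (a b c t k : ℕ) :
    residueCoeff a b c (Complex.exp (2 * Real.pi * Complex.I / a) ^ k) *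
        (Complex.exp (2 * Real.pi * Complex.I / a) ^ k) ^ t =
      -(1 / (4 * (a : ℂ))) * (Complex.exp (Real.pi * Complex.I * k / a * (2 * t + b + c)) /
        ((Real.sin (Real.pi * k * b / a) : ℂ) * (Real.sin (Real.pi * k * c / a) : ℂ))) := by
  have hfac (n : ℕ) : 1 - (Complex.exp (2 * Real.pi * Complex.I / a) ^ k)⁻¹ ^ n =
      2 * Complex.I * Complex.exp (-((Real.pi * k * n / a : ℝ) * Complex.I)) *
        (Real.sin (Real.pi * k * n / a) : ℂ) := by
    rw [← one_sub_exp_neg, ← Complex.exp_nat_mul, ← Complex.exp_neg, ← Complex.exp_nat_mul]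
    push_cast
    ring_nf
  have hexp : Complex.exp (Real.pi * Complex.I * k / a * (2 * t + b + c)) =
      (Complex.exp (2 * Real.pi * Complex.I / a) ^ k) ^ t *
        ((Complex.exp (-((Real.pi * k * b / a : ℝ) * Complex.I)))⁻¹ *
          (Complex.exp (-((Real.pi * k * c / a : ℝ) * Complex.I)))⁻¹) := by
    rw [← Complex.exp_neg, ← Complex.exp_neg, ← Complex.exp_nat_mul, ← Complex.exp_nat_mul,
      ← Complex.exp_add, ← Complex.exp_add]
    push_cast
    ring_nf
  have hcomb (x y u v w : ℂ) : (a * ((2 * Complex.I * x * u) * (2 * Complex.I * y * v)))⁻¹ * w =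
      -(1 / (4 * (a : ℂ))) * (w * (x⁻¹ * y⁻¹) / (u * v)) := by
    have : a * ((2 * Complex.I * x * u) * (2 * Complex.I * y * v)) = -(4 * a * x * y * u * v) := by
      linear_combination 4 * a * x * y * u * v * Complex.I_sq
    rw [this]
    ring
  rw [residueCoeff, hfac, hfac, hexp, hcomb]

theorem sum_residueCoeff {a : ℕ} (ha : 0 < a) (b c t : ℕ) :
    ∑ μ ∈ nontrivialRoots a, residueCoeff a b c μ * μ ^ t =
      -(1 / (4 * (a : ℂ))) * ∑ k ∈ Finset.Icc 1 (a - 1),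
          Complex.exp (Real.pi * Complex.I * k / a * (2 * t + b + c)) /
            ((Real.sin (Real.pi * k * b / a) : ℂ) * (Real.sin (Real.pi * k * c / a) : ℂ)) := by
  rw [sum_nontrivialRoots ha, Finset.mul_sum]
  exact Finset.sum_congr rfl fun k _ => residueCoeff_mul_pow a b c t k

/-- For pairwise coprime positive integers `a, b, c` and `t ≥ 0`, `N_t(a,b,c)`
equals the polynomial part
`t²/(2abc) + (t/2)(1/(ab)+1/(ac)+1/(bc)) + (1/12)(3/a+3/b+3/c+a/(bc)+b/(ac)+c/(ab))`
minus the three Dedekind–Rademacher (sine) sums. -/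
theorem frobN_eq_polynomial_sub_sineSums (a b c : ℕ)
    (ha : 0 < a) (hb : 0 < b) (hc : 0 < c)
    (hab : Nat.Coprime a b) (hac : Nat.Coprime a c) (hbc : Nat.Coprime b c)
    (t : ℕ) :
    (frobN a b c t : ℂ) =
      (t : ℂ) ^ 2 / (2 * a * b * c) +
        ((t : ℂ) / 2) * (1 / (a * b) + 1 / (a * c) + 1 / (b * c)) +
        (1 / 12) * (3 / a + 3 / b + 3 / c + a / (b * c) + b / (a * c) + c / (a * b)) -
        (1 / (4 * (a : ℂ))) * ∑ k ∈ Finset.Icc 1 (a - 1),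
          Complex.exp (Real.pi * Complex.I * k / a * (2 * t + b + c)) /
            ((Real.sin (Real.pi * k * b / a) : ℂ) * (Real.sin (Real.pi * k * c / a) : ℂ)) -
        (1 / (4 * (b : ℂ))) * ∑ k ∈ Finset.Icc 1 (b - 1),
          Complex.exp (Real.pi * Complex.I * k / b * (2 * t + a + c)) /
            ((Real.sin (Real.pi * k * a / b) : ℂ) * (Real.sin (Real.pi * k * c / b) : ℂ)) -
        (1 / (4 * (c : ℂ))) * ∑ k ∈ Finset.Icc 1 (c - 1),
          Complex.exp (Real.pi * Complex.I * k / c * (2 * t + a + b)) /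
            ((Real.sin (Real.pi * k * a / c) : ℂ) * (Real.sin (Real.pi * k * b / c) : ℂ)) := by
  have ha' : (a : ℂ) ≠ 0 := Nat.cast_ne_zero.mpr ha.ne'
  have hb' : (b : ℂ) ≠ 0 := Nat.cast_ne_zero.mpr hb.ne'
  have hc' : (c : ℂ) ≠ 0 := Nat.cast_ne_zero.mpr hc.ne'
  have hlin : ((a : ℂ) + b + c) / (a * b * c) = 1 / (a * b) + 1 / (a * c) + 1 / (b * c) := by
    field_simp
    ring
  rw [frobN_eq_sum_residueCoeff ha hb hc hab hac hbc, sum_residueCoeff ha, sum_residueCoeff hb,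
    sum_residueCoeff hc, hlin]
  ring
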